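/- The sequence R_4(n)/n³ converges to 1/9 as n → ∞; equivalently, R_4(n) ~ (1/9)n³. -/

import Mathlib

/-- The `i`-th largest part (1-indexed) of a partition, or `0` if out of range. -/
def part {n : ℕ} (p : n.Partition) (i : ℕ) : ℕ :=
  (p.parts.sort (· ≥ ·)).getD (i - 1) 0

open Classical in
/-- The size of the Durfee triangle of a partition: the largest `k` such that
`λ_i ≥ k + 1 - i` for all `1 ≤ i ≤ k`. -/
noncomputable def durfee {n : ℕ} (p : n.Partition) : ℕ :=
  Nat.findGreatest (fun k => ∀ i ∈ Finset.Icc 1 k, k + 1 ≤ part p i + i) n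

open Classical in
/-- `R k n` : the number of partitions of `n` with Durfee triangle size exactly `k`. -/
noncomputable def R (k n : ℕ) : ℕ :=
  (Finset.univ.filter fun p : n.Partition => durfee p = k).card

/-- The partition function. -/
def P (n : ℕ) : ℕ := Fintype.card n.Partition

/-- The maximal Durfee triangle size among partitions of `n`. -/
noncomputable def F (n : ℕ) : ℕ := Finset.univ.sup fun p : n.Partition => durfee p

open Finset in
/-- Lattice points of a weighted simplex. -/
def simp3 (w1 w2 w3 N : ℕ) : Finset (Σ _ : ℕ, Σ _ : ℕ, ℕ) :=
  (range (N / w1 + 1)).sigma fun x => (range ((N - w1 * x) / w2 + 1)).sigma fun y =>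
    range ((N - w1 * x - w2 * y) / w3 + 1)

theorem mem_simp3 {w1 w2 w3 N x y z : ℕ} (h1 : 0 < w1) (h2 : 0 < w2) (h3 : 0 < w3) :
    (⟨x, y, z⟩ : Σ _ : ℕ, Σ _ : ℕ, ℕ) ∈ simp3 w1 w2 w3 N ↔ w1 * x + w2 * y + w3 * z ≤ N := by
  simp only [simp3, Finset.mem_sigma, Finset.mem_range, Nat.lt_succ_iff, Nat.le_div_iff_mul_le h1,
    Nat.le_div_iff_mul_le h2, Nat.le_div_iff_mul_le h3]
  rw [mul_comm x, mul_comm y, mul_comm z]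
  omega

/-- Iterated summation along steps of size `w`. -/
def stepSum (w : ℕ) (f : ℕ → ℕ) (N : ℕ) : ℕ := ∑ x ∈ Finset.range (N / w + 1), f (N - w * x)

theorem stepSum_lt {w : ℕ} (f : ℕ → ℕ) {N : ℕ} (h : N < w) : stepSum w f N = f N := by
  simp [stepSum, Nat.div_eq_of_lt h]

theorem stepSum_add {w : ℕ} (hw : 0 < w) (f : ℕ → ℕ) (N : ℕ) :
    stepSum w f (N + w) = stepSum w f N + f (N + w) := by
  unfold stepSum
  rw [Nat.add_div_right _ hw, Finset.sum_range_succ']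
  simp only [mul_zero, Nat.sub_zero]
  congr 1
  apply Finset.sum_congr rfl
  intro x _
  congr 1
  rw [mul_add, mul_one]
  omega

theorem stepSum_lower {w : ℕ} (hw : 0 < w) (f : ℕ → ℕ) (l L : ℕ → ℝ) (h : ∀ N, l N ≤ f N)
    (h0 : ∀ N, N < w → L N ≤ l N) (h1 : ∀ N, L (N + w) ≤ L N + l (N + w)) (N : ℕ) :
    L N ≤ stepSum w f N := by
  induction N using Nat.strong_induction_on with
  | _ N ih =>
    rcases lt_or_ge N w with hN | hN
    · rw [stepSum_lt f hN]; exact (h0 N hN).trans (h N)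
    · obtain ⟨M, rfl⟩ := Nat.exists_eq_add_of_le' hN
      rw [stepSum_add hw]
      push_cast
      have := ih M (by omega)
      linarith [h1 M, h (M + w)]

theorem stepSum_upper {w : ℕ} (hw : 0 < w) (f : ℕ → ℕ) (l L : ℕ → ℝ) (h : ∀ N, f N ≤ l N)
    (h0 : ∀ N, N < w → l N ≤ L N) (h1 : ∀ N, L N + l (N + w) ≤ L (N + w)) (N : ℕ) :
    stepSum w f N ≤ L N := by
  induction N using Nat.strong_induction_on with
  | _ N ih =>
    rcases lt_or_ge N w with hN | hN
    · rw [stepSum_lt f hN]; exact (h N).trans (h0 N hN)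
    · obtain ⟨M, rfl⟩ := Nat.exists_eq_add_of_le' hN
      rw [stepSum_add hw]
      push_cast
      have := ih M (by omega)
      linarith [h1 M, h (M + w)]

theorem card_simp3 (w1 w2 w3 N : ℕ) :
    (simp3 w1 w2 w3 N).card = stepSum w1 (stepSum w2 (stepSum w3 fun _ => 1)) N := by
  simp [simp3, stepSum, Finset.card_sigma]

theorem simp3_lower {w1 w2 w3 : ℕ} (h1 : 0 < w1) (h2 : 0 < w2) (h3 : 0 < w3) (N : ℕ) :
    (N : ℝ) ^ 3 / (6 * w1 * w2 * w3) ≤ (simp3 w1 w2 w3 N).card := by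
  rw [card_simp3]
  have p1 : (0 : ℝ) < w1 := by exact_mod_cast h1
  have p2 : (0 : ℝ) < w2 := by exact_mod_cast h2
  have p3 : (0 : ℝ) < w3 := by exact_mod_cast h3
  have A : ∀ N : ℕ, (N : ℝ) / w3 ≤ stepSum w3 (fun _ => 1) N := by
    apply stepSum_lower h3 _ (fun _ => 1)
    · simp
    · intro N hN
      have : (N : ℝ) < w3 := by exact_mod_cast hN
      rw [div_le_one p3]; exact this.le
    · intro N
      push_cast
      rw [add_div, div_self p3.ne']
  have B : ∀ N : ℕ, (N : ℝ) ^ 2 / (2 * w2 * w3) ≤ stepSum w2 (stepSum w3 (fun _ => 1)) N := by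
    apply stepSum_lower h2 _ (fun N => (N : ℝ) / w3) _ A
    · intro N hN
      have : (N : ℝ) < w2 := by exact_mod_cast hN
      rw [div_le_div_iff₀ (by positivity) p3]
      have h0 : (0 : ℝ) ≤ N := by positivity
      have : (N : ℝ) * N ≤ N * (2 * w2) := by nlinarith
      nlinarith
    · intro N
      push_cast
      rw [← sub_nonneg]
      have : (N : ℝ) ^ 2 / (2 * w2 * w3) + (N + w2) / w3 - (N + w2) ^ 2 / (2 * w2 * w3)
        = w2 / (2 * w3) := by field_simp; ring
      rw [this]; positivity
  refine stepSum_lower h1 _ (fun N => (N : ℝ) ^ 2 / (2 * w2 * w3))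
    (fun N => (N : ℝ) ^ 3 / (6 * w1 * w2 * w3)) B ?_ ?_ N
  · intro N hN
    have : (N : ℝ) < w1 := by exact_mod_cast hN
    have h0 : (0 : ℝ) ≤ N := by positivity
    rw [← sub_nonneg]
    have e : (N : ℝ) ^ 2 / (2 * w2 * w3) - (N : ℝ) ^ 3 / (6 * w1 * w2 * w3)
        = N ^ 2 * (3 * w1 - N) / (6 * w1 * w2 * w3) := by field_simp; ring
    rw [e]
    have : (0 : ℝ) ≤ 3 * w1 - N := by linarith
    positivity
  · intro N
    push_cast
    rw [← sub_nonneg]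
    have : (N : ℝ) ^ 3 / (6 * w1 * w2 * w3) + (N + w1) ^ 2 / (2 * w2 * w3)
       - (N + w1) ^ 3 / (6 * w1 * w2 * w3)
      = (3 * N * w1 + 2 * w1 ^ 2) / (6 * w2 * w3) := by field_simp; ring
    rw [this]; positivity

theorem simp3_upper {w1 w2 w3 : ℕ} (h1 : 0 < w1) (h2 : 0 < w2) (h3 : 0 < w3) (N : ℕ) :
    ((simp3 w1 w2 w3 N).card : ℝ) ≤ (N + w1 + w2 + w3 : ℝ) ^ 3 / (6 * w1 * w2 * w3) := by
  rw [card_simp3]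
  have p1 : (0 : ℝ) < w1 := by exact_mod_cast h1
  have p2 : (0 : ℝ) < w2 := by exact_mod_cast h2
  have p3 : (0 : ℝ) < w3 := by exact_mod_cast h3
  have A : ∀ N : ℕ, (stepSum w3 (fun _ => 1) N : ℝ) ≤ (N + w3 : ℝ) / w3 := by
    apply stepSum_upper h3 _ (fun _ => 1)
    · simp
    · intro N hN
      rw [le_div_iff₀ p3]
      have h0 : (0 : ℝ) ≤ N := by positivity
      linarith
    · intro N
      push_cast
      apply le_of_eq
      field_simp
  have B : ∀ N : ℕ, (stepSum w2 (stepSum w3 (fun _ => 1)) N : ℝ)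
      ≤ (N + w2 + w3 : ℝ) ^ 2 / (2 * w2 * w3) := by
    apply stepSum_upper h2 _ (fun N => (N + w3 : ℝ) / w3) _ A
    · intro N hN
      rw [← sub_nonneg]
      have e : (N + w2 + w3 : ℝ) ^ 2 / (2 * w2 * w3) - (N + w3 : ℝ) / w3
        = ((N + w3) ^ 2 + w2 ^ 2) / (2 * w2 * w3) := by field_simp; ring
      rw [e]; positivity
    · intro N
      push_cast
      rw [← sub_nonneg]
      have : (N + w2 + w2 + w3 : ℝ) ^ 2 / (2 * w2 * w3) -
          ((N + w2 + w3 : ℝ) ^ 2 / (2 * w2 * w3) + (N + w2 + w3) / w3)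
        = w2 / (2 * w3) := by field_simp; ring
      rw [this]; positivity
  refine stepSum_upper h1 _ (fun N => (N + w2 + w3 : ℝ) ^ 2 / (2 * w2 * w3))
    (fun N => (N + w1 + w2 + w3 : ℝ) ^ 3 / (6 * w1 * w2 * w3)) B ?_ ?_ N
  · intro N hN
    rw [← sub_nonneg]
    have e : (N + w1 + w2 + w3 : ℝ) ^ 3 / (6 * w1 * w2 * w3)
        - (N + w2 + w3 : ℝ) ^ 2 / (2 * w2 * w3)
        = ((N + w2 + w3) ^ 3 + 3 * (N + w2 + w3) * w1 ^ 2 + w1 ^ 3) / (6 * w1 * w2 * w3) := by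
      field_simp; ring
    rw [e]
    positivity
  · intro N
    push_cast
    rw [← sub_nonneg]
    have : (N + w1 + w1 + w2 + w3 : ℝ) ^ 3 / (6 * w1 * w2 * w3)
       - ((N + w1 + w2 + w3 : ℝ) ^ 3 / (6 * w1 * w2 * w3)
          + (N + w1 + w2 + w3) ^ 2 / (2 * w2 * w3))
      = (3 * (N + w1 + w2 + w3) * w1 + w1 ^ 2) / (6 * w2 * w3) := by field_simp; ring
    rw [this]; positivity

theorem part_of_list {n : ℕ} (p : n.Partition) (l : List ℕ) (hl : p.parts = ↑l)
    (hs : l.Pairwise (· ≥ ·)) (i : ℕ) : part p i = l.getD (i - 1) 0 := by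
  unfold part
  congr 1
  apply List.Perm.eq_of_pairwise (le := (· ≥ ·)) _ (Multiset.pairwise_sort _ _) hs
  · rw [← Multiset.coe_eq_coe, Multiset.sort_eq, hl]
  · intro a b _ _ h1 h2
    exact le_antisymm h2 h1

theorem durfee_eq_four_iff' {n : ℕ} (hn : 5 ≤ n) (p : n.Partition) :
    durfee p = 4 ↔ (4 ≤ part p 1 ∧ 3 ≤ part p 2 ∧ 2 ≤ part p 3 ∧ 1 ≤ part p 4) ∧
      (part p 1 ≤ 4 ∨ part p 2 ≤ 3 ∨ part p 3 ≤ 2 ∨ part p 4 ≤ 1 ∨ part p 5 = 0) := by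
  classical
  unfold durfee
  refine (@Nat.findGreatest_eq_iff 4 n _ (fun a => Classical.propDecidable _)).trans ?_
  constructor
  · rintro ⟨_, h4, h5⟩
    have h4 := h4 (by norm_num)
    have h5 := @h5 5 (by norm_num) hn
    refine ⟨⟨?_, ?_, ?_, ?_⟩, ?_⟩
    · have := h4 1 (by simp); omega
    · have := h4 2 (by simp); omega
    · have := h4 3 (by simp); omega
    · have := h4 4 (by simp); omega
    · by_contra hc
      apply h5
      intro i hi
      rw [Finset.mem_Icc] at hi
      obtain ⟨a, b⟩ := hi
      interval_cases i <;> omega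
  · rintro ⟨h, h'⟩
    refine ⟨by omega, ?_, ?_⟩
    · intro _ i hi
      rw [Finset.mem_Icc] at hi
      obtain ⟨a, b⟩ := hi
      interval_cases i <;> omega
    · intro k hk _ hP
      have a1 := hP 1 (by rw [Finset.mem_Icc]; omega)
      have a2 := hP 2 (by rw [Finset.mem_Icc]; omega)
      have a3 := hP 3 (by rw [Finset.mem_Icc]; omega)
      have a4 := hP 4 (by rw [Finset.mem_Icc]; omega)
      have a5 := hP 5 (by rw [Finset.mem_Icc]; omega)
      omega

/-- Small parts, in decreasing order. -/
def rep (c1 c2 c3 c4 : ℕ) : List ℕ :=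
  List.replicate c4 4 ++ (List.replicate c3 3 ++ (List.replicate c2 2 ++ List.replicate c1 1))

theorem rep_sum (c1 c2 c3 c4 : ℕ) : (rep c1 c2 c3 c4).sum = c1 + 2 * c2 + 3 * c3 + 4 * c4 := by
  simp [rep]; ring

theorem rep_of_le (l : List ℕ) (h0 : ∀ x ∈ l, 0 < x) (h4 : ∀ x ∈ l, x ≤ 4) :
    (l : Multiset ℕ) = rep (l.count 1) (l.count 2) (l.count 3) (l.count 4) := by
  ext a
  simp only [rep, Multiset.coe_count, List.count_append, List.count_replicate]
  by_cases ha : a ∈ l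
  · have := h0 a ha
    have := h4 a ha
    interval_cases a <;> simp
  · have := List.count_eq_zero_of_not_mem ha
    rw [this]
    by_cases a = 1
    · subst a; simp [this]
    by_cases a = 2
    · subst a; simp [this]
    by_cases a = 3
    · subst a; simp [this]
    by_cases a = 4
    · subst a; simp [this]
    have e1 : ¬ (1 = a) := by omega
    have e2 : ¬ (2 = a) := by omega
    have e3 : ¬ (3 = a) := by omega
    have e4 : ¬ (4 = a) := by omega
    simp [e1, e2, e3, e4]

theorem rep_ex (l : List ℕ) (h0 : ∀ x ∈ l, 0 < x) (b : ℕ) (hb : b ≤ 4) (h : ∀ x ∈ l, x ≤ b) :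
    ∃ c1 c2 c3 c4, (l : Multiset ℕ) = rep c1 c2 c3 c4 ∧ l.sum = c1 + 2 * c2 + 3 * c3 + 4 * c4 ∧
      (b ≤ 3 → c4 = 0) ∧ (b ≤ 2 → c3 = 0) ∧ (b ≤ 1 → c2 = 0) := by
  have key := rep_of_le l h0 (fun x hx => (h x hx).trans hb)
  refine ⟨_, _, _, _, key, ?_, ?_, ?_, ?_⟩
  · rw [← rep_sum, ← Multiset.sum_coe, ← Multiset.sum_coe, ← key]
  all_goals
    intro hb'
    apply List.count_eq_zero_of_not_mem
    intro hm
    have := h _ hm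
    omega

theorem rep_inj {c1 c2 c3 c4 d1 d2 d3 d4 : ℕ} (h : rep c1 c2 c3 c4 = rep d1 d2 d3 d4) :
    c1 = d1 ∧ c2 = d2 ∧ c3 = d3 ∧ c4 = d4 := by
  have a1 := congrArg (List.count 1) h
  have a2 := congrArg (List.count 2) h
  have a3 := congrArg (List.count 3) h
  have a4 := congrArg (List.count 4) h
  simp [rep, List.count_append, List.count_replicate] at a1 a2 a3 a4
  exact ⟨a1, a2, a3, a4⟩

open Classical in
/-- The multisets underlying the partitions counted by `R 4 n`. -/
noncomputable def S4 (n : ℕ) : Finset (Multiset ℕ) :=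
  (Finset.univ.filter fun p : n.Partition => durfee p = 4).image Nat.Partition.parts

theorem card_S4 (n : ℕ) : (S4 n).card = R 4 n := by
  unfold S4 R
  apply Finset.card_image_of_injective
  intro p q h
  exact Nat.Partition.ext h

/-- Upper families: the slack goes into `n - …`. -/
def U (n : ℕ) : ℕ → (Σ _ : ℕ, Σ _ : ℕ, ℕ) → Multiset ℕ
  | 0, ⟨x, y, z⟩ => ↑(rep (n - (2 * x + 3 * y + 4 * z)) x y z)
  | 1, ⟨x, y, z⟩ => ↑((n - (1 * x + 2 * y + 3 * z)) :: rep x y z 0)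
  | 2, ⟨x, y, z⟩ => ↑((x + y) :: y :: rep (n - (1 * x + 2 * y + 2 * z)) z 0 0)
  | 3, ⟨x, y, z⟩ => ↑((x + y + z) :: (y + z) :: z :: rep (n - (1 * x + 2 * y + 3 * z)) 0 0 0)
  | _, ⟨x, y, z⟩ => ↑[n - (2 * x + 3 * y + 4 * z) + x + y + z, x + y + z, y + z, z]

/-- The weights. -/
def W : ℕ → ℕ → Finset (Σ _ : ℕ, Σ _ : ℕ, ℕ)
  | 0 => simp3 2 3 4
  | 1 => simp3 1 2 3
  | 2 => simp3 1 2 2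
  | 3 => simp3 1 2 3
  | _ => simp3 2 3 4

/-- Lower families. -/
def Lo (n : ℕ) : ℕ → (Σ _ : ℕ, Σ _ : ℕ, ℕ) → List ℕ
  | 0, ⟨x, y, z⟩ => 4 :: 4 :: 4 :: 4 :: rep (n - (2 * x + 3 * y + 4 * z + 16)) x y z
  | 1, ⟨x, y, z⟩ => (5 + (n - (1 * x + 2 * y + 3 * z + 14))) :: 3 :: 3 :: 3 :: rep x y z 0
  | 2, ⟨x, y, z⟩ =>
    (5 + x + y) :: (5 + y) :: 2 :: 2 :: rep (n - (1 * x + 2 * y + 2 * z + 14)) z 0 0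
  | 3, ⟨x, y, z⟩ => (5 + x + y + z) :: (5 + y + z) :: (5 + z) :: 1 ::
      rep (n - (1 * x + 2 * y + 3 * z + 16)) 0 0 0
  | _, ⟨x, y, z⟩ => [n - (2 * x + 3 * y + 4 * z + 20) + 5 + x + y + z, 5 + x + y + z,
      5 + y + z, 5 + z]

theorem Lo_sorted (n k : ℕ) (v) : (Lo n k v).Pairwise (· ≥ ·) := by
  obtain ⟨x, y, z⟩ := v
  unfold Lo
  split <;> simp only [rep, List.pairwise_cons, List.pairwise_append, List.pairwise_replicate,
    List.mem_append, List.mem_replicate, List.mem_cons] <;> grind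

theorem Lo_pos (n k : ℕ) (v) : ∀ i ∈ Lo n k v, 0 < i := by
  obtain ⟨x, y, z⟩ := v
  unfold Lo
  split <;> simp only [rep, 
    List.mem_append, List.mem_replicate, List.mem_cons] <;> grind

theorem Lo_sum (n k : ℕ) (hn : 20 ≤ n) (v) (hv : v ∈ W k (n - 20)) : (Lo n k v).sum = n := by
  obtain ⟨x, y, z⟩ := v
  unfold Lo
  unfold W at hv
  split at hv <;> rw [mem_simp3 (by norm_num) (by norm_num) (by norm_num)] at hv <;>
  simp only [List.sum_cons, rep_sum, List.sum_nil] <;> omega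

theorem Lo_countP (n k : ℕ) (hk : k < 5) (v) : (Lo n k v).countP (5 ≤ ·) = k := by
  obtain ⟨x, y, z⟩ := v
  unfold Lo
  interval_cases k <;> simp [rep, List.countP_cons, List.countP_append, List.countP_replicate] <;>
    grind

theorem Lo_inj (n k : ℕ) (v v') (hn : 20 ≤ n) (h : v ∈ W k (n - 20)) (h' : v' ∈ W k (n - 20))
    (e : Lo n k v = Lo n k v') : v = v' := by
  obtain ⟨x, y, z⟩ := v
  obtain ⟨x', y', z'⟩ := v'
  suffices x = x' ∧ y = y' ∧ z = z' by
    obtain ⟨rfl, rfl, rfl⟩ := this; rfl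
  rcases k with _ | _ | _ | _ | k <;> simp only [Lo, List.cons.injEq, true_and] at e
  · have := rep_inj e
    omega
  · have := rep_inj e.2
    omega
  · have := rep_inj e.2.2
    omega
  · omega
  · omega

theorem Lo_mem (n k : ℕ) (hn : 20 ≤ n) (v) (hv : v ∈ W k (n - 20)) :
    (Lo n k v : Multiset ℕ) ∈ S4 n := by
  classical
  unfold S4
  rw [Finset.mem_image]
  let p : n.Partition := ⟨Lo n k v, fun {i} hi => Lo_pos n k v i (by simpa using hi), by
    rw [Multiset.sum_coe]; exact Lo_sum n k hn v hv⟩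
  refine ⟨p, ?_, rfl⟩
  rw [Finset.mem_filter]
  refine ⟨Finset.mem_univ _, ?_⟩
  have hp := part_of_list p (Lo n k v) rfl (Lo_sorted n k v)
  rw [durfee_eq_four_iff' (by omega)]
  simp only [hp]
  obtain ⟨x, y, z⟩ := v
  unfold Lo
  split <;> simp <;> omega

theorem S4_sub (n : ℕ) (hn : 20 ≤ n) (s) (hs : s ∈ S4 n) :
    ∃ k < 5, ∃ v ∈ W k n, U n k v = s := by
  classical
  unfold S4 at hs
  rw [Finset.mem_image] at hs
  obtain ⟨p, hp, rfl⟩ := hs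
  rw [Finset.mem_filter] at hp
  have hd := hp.2
  rw [durfee_eq_four_iff' (by omega)] at hd
  obtain ⟨l, hl⟩ : ∃ l, l = p.parts.sort (· ≥ ·) := ⟨_, rfl⟩
  have hpl : p.parts = ↑l := by rw [hl, Multiset.sort_eq]
  have hs : l.Pairwise (· ≥ ·) := hl ▸ Multiset.pairwise_sort _ _
  have hpart := part_of_list p l hpl hs
  have hpos : ∀ i ∈ l, 0 < i := fun i hi => p.parts_pos (by rw [hpl]; simpa using hi)
  have hsum : l.sum = n := by rw [← Multiset.sum_coe, ← hpl, p.parts_sum]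
  simp only [hpart] at hd
  rw [hpl]
  clear hpart hpl hl hp
  match l, hd, hs, hpos, hsum with
  | [], hd, hs, hpos, hsum => simp at hd
  | [_], hd, hs, hpos, hsum => simp at hd
  | [_, _], hd, hs, hpos, hsum => simp at hd
  | [_, _, _], hd, hs, hpos, hsum => simp at hd
  | a :: b :: c :: d :: t, hd, hs, hpos, hsum =>
    simp only [List.pairwise_cons, List.mem_cons] at hs
    have hab : b ≤ a := hs.1 b (by simp)
    have hbc : c ≤ b := hs.2.1 c (by simp)
    have hcd : d ≤ c := hs.2.2.1 d (by simp)
    have hdt : ∀ x ∈ t, x ≤ d := hs.2.2.2.1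
    clear hs
    obtain ⟨-, hd⟩ := hd
    simp only [Nat.sub_self, Nat.reduceSub, List.getD_cons_zero, List.getD_cons_succ] at hd
    rcases hd with h | h | h | h | h
    · obtain ⟨c1, c2, c3, c4, key, hsum', -, -, -⟩ :=
        rep_ex (a :: b :: c :: d :: t) hpos a h (by grind)
      refine ⟨0, by norm_num, ⟨c2, c3, c4⟩,
        (mem_simp3 (by norm_num) (by norm_num) (by norm_num)).2 (by omega), ?_⟩
      have e : n - (2 * c2 + 3 * c3 + 4 * c4) = c1 := by omega
      simp only [U]
      rw [e, key]
    · obtain ⟨c1, c2, c3, c4, key, hsum', h4, -, -⟩ :=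
        rep_ex (b :: c :: d :: t) (by grind) b (by omega) (by grind)
      obtain rfl := h4 h
      rw [List.sum_cons, hsum'] at hsum
      refine ⟨1, by norm_num, ⟨c1, c2, c3⟩,
        (mem_simp3 (by norm_num) (by norm_num) (by norm_num)).2 (by omega), ?_⟩
      have e : n - (1 * c1 + 2 * c2 + 3 * c3) = a := by omega
      simp only [U, ← Multiset.cons_coe] at key ⊢
      rw [e, key]
    · obtain ⟨c1, c2, c3, c4, key, hsum', h4, h3, -⟩ :=
        rep_ex (c :: d :: t) (by grind) c (by omega) (by grind)
      obtain rfl := h4 (by omega)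
      obtain rfl := h3 (by omega)
      rw [List.sum_cons, List.sum_cons, hsum'] at hsum
      refine ⟨2, by norm_num, ⟨a - b, b, c2⟩,
        (mem_simp3 (by norm_num) (by norm_num) (by norm_num)).2 (by omega), ?_⟩
      have e : n - (1 * (a - b) + 2 * b + 2 * c2) = c1 := by omega
      have e' : a - b + b = a := by omega
      simp only [U, ← Multiset.cons_coe] at key ⊢
      rw [e, e', key]
    · obtain ⟨c1, c2, c3, c4, key, hsum', h4, h3, h2⟩ :=
        rep_ex (d :: t) (by grind) d (by omega) (by grind)
      obtain rfl := h4 (by omega)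
      obtain rfl := h3 (by omega)
      obtain rfl := h2 (by omega)
      rw [List.sum_cons, List.sum_cons, List.sum_cons, hsum'] at hsum
      refine ⟨3, by norm_num, ⟨a - b, b - c, c⟩,
        (mem_simp3 (by norm_num) (by norm_num) (by norm_num)).2 (by omega), ?_⟩
      have e : n - (1 * (a - b) + 2 * (b - c) + 3 * c) = c1 := by omega
      have e' : a - b + (b - c) + c = a := by omega
      have e'' : b - c + c = b := by omega
      simp only [U, ← Multiset.cons_coe] at key ⊢
      rw [e, e', e'', key]
    · obtain rfl : t = [] := by
        cases t with
        | nil => rfl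
        | cons u t =>
          have := hpos u (by simp)
          simp at h
          omega
      simp only [List.sum_cons, List.sum_nil] at hsum
      refine ⟨4, by norm_num, ⟨b - c, c - d, d⟩,
        (mem_simp3 (by norm_num) (by norm_num) (by norm_num)).2 (by omega), ?_⟩
      have e : n - (2 * (b - c) + 3 * (c - d) + 4 * d) + (b - c) + (c - d) + d = a := by omega
      have e' : b - c + (c - d) + d = b := by omega
      have e'' : c - d + d = c := by omega
      simp only [U]
      rw [e, e', e'']

theorem R_upper (n : ℕ) (hn : 20 ≤ n) : (R 4 n : ℝ) ≤ ((n : ℝ) + 9) ^ 3 / 9 := by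
  classical
  have h : R 4 n ≤ ∑ k ∈ Finset.range 5, (W k n).card := by
    rw [← card_S4]
    calc (S4 n).card ≤ ((Finset.range 5).biUnion fun k => (W k n).image (U n k)).card := by
          apply Finset.card_le_card
          intro s hs
          obtain ⟨k, hk, v, hv, e⟩ := S4_sub n hn s hs
          rw [Finset.mem_biUnion]
          exact ⟨k, Finset.mem_range.2 hk, Finset.mem_image.2 ⟨v, hv, e⟩⟩
      _ ≤ ∑ k ∈ Finset.range 5, ((W k n).image (U n k)).card := Finset.card_biUnion_le
      _ ≤ _ := Finset.sum_le_sum fun k _ => Finset.card_image_le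
  have h' : (R 4 n : ℝ) ≤ ∑ k ∈ Finset.range 5, ((W k n).card : ℝ) := by exact_mod_cast h
  simp only [Finset.sum_range_succ, Finset.sum_range_zero, W] at h'
  have a1 := @simp3_upper 2 3 4 (by norm_num) (by norm_num) (by norm_num) n
  have a2 := @simp3_upper 1 2 3 (by norm_num) (by norm_num) (by norm_num) n
  have a3 := @simp3_upper 1 2 2 (by norm_num) (by norm_num) (by norm_num) n
  have h0 : (0 : ℝ) ≤ n := by positivity
  have b2 : ((n : ℝ) + 6) ^ 3 ≤ (n + 9) ^ 3 := by gcongr; norm_num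
  have b3 : ((n : ℝ) + 5) ^ 3 ≤ (n + 9) ^ 3 := by gcongr; norm_num
  push_cast at a1 a2 a3
  norm_num [add_assoc] at a1 a2 a3
  linarith

theorem R_lower (n : ℕ) (hn : 20 ≤ n) : ((n : ℝ) - 20) ^ 3 / 9 ≤ (R 4 n : ℝ) := by
  classical
  have h : ∑ k ∈ Finset.range 5, (W k (n - 20)).card ≤ R 4 n := by
    rw [← card_S4]
    have inj : ∀ k k' v v', k < 5 → k' < 5 → (Lo n k v : Multiset ℕ) = Lo n k' v' →
        k = k' ∧ Lo n k v = Lo n k' v' := by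
      intro k k' v v' hk hk' e
      rw [Multiset.coe_eq_coe] at e
      constructor
      · rw [← Lo_countP n k hk v, ← Lo_countP n k' hk' v']
        exact e.countP_eq _
      · exact List.Perm.eq_of_pairwise (le := (· ≥ ·)) (fun a b _ _ h1 h2 => le_antisymm h2 h1)
          (Lo_sorted n k v) (Lo_sorted n k' v') e
    calc ∑ k ∈ Finset.range 5, (W k (n - 20)).card
        = ∑ k ∈ Finset.range 5,
            ((W k (n - 20)).image fun v => (Lo n k v : Multiset ℕ)).card := by
          apply Finset.sum_congr rfl
          intro k hk
          rw [Finset.mem_range] at hk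
          rw [Finset.card_image_of_injOn]
          intro v hv v' hv' e
          exact Lo_inj n k v v' hn hv hv' (inj k k v v' hk hk e).2
      _ = ((Finset.range 5).biUnion
            fun k => (W k (n - 20)).image fun v => (Lo n k v : Multiset ℕ)).card := by
          rw [Finset.card_biUnion]
          intro k hk k' hk' hne
          rw [Finset.mem_coe, Finset.mem_range] at hk hk'
          simp only [Function.onFun]
          rw [Finset.disjoint_left]
          intro s hs hs'
          rw [Finset.mem_image] at hs hs'
          obtain ⟨v, -, rfl⟩ := hs
          obtain ⟨v', -, e⟩ := hs'
          exact hne (inj k k' v v' hk hk' e.symm).1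
      _ ≤ _ := by
          apply Finset.card_le_card
          intro s hs
          rw [Finset.mem_biUnion] at hs
          obtain ⟨k, hk, hs⟩ := hs
          rw [Finset.mem_image] at hs
          obtain ⟨v, hv, rfl⟩ := hs
          exact Lo_mem n k hn v hv
  have h' : ∑ k ∈ Finset.range 5, ((W k (n - 20)).card : ℝ) ≤ (R 4 n : ℝ) := by exact_mod_cast h
  simp only [Finset.sum_range_succ, Finset.sum_range_zero, W] at h'
  have a1 := @simp3_lower 2 3 4 (by norm_num) (by norm_num) (by norm_num) (n - 20)
  have a2 := @simp3_lower 1 2 3 (by norm_num) (by norm_num) (by norm_num) (n - 20)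
  have a3 := @simp3_lower 1 2 2 (by norm_num) (by norm_num) (by norm_num) (n - 20)
  rw [Nat.cast_sub hn] at a1 a2 a3
  push_cast at a1 a2 a3
  norm_num at a1 a2 a3
  linarith

theorem shift_tendsto (c : ℝ) : Filter.Tendsto (fun n : ℕ => ((n : ℝ) + c) ^ 3 / 9 / (n : ℝ) ^ 3)
    Filter.atTop (nhds (1 / 9)) := by
  have h : Filter.Tendsto (fun n : ℕ => (1 + c / (n : ℝ)) ^ 3 / 9) Filter.atTop
      (nhds ((1 + 0) ^ 3 / 9)) :=
    ((tendsto_const_nhds.add (tendsto_const_div_atTop_nhds_zero_nat c)).pow 3).div_const 9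
  rw [add_zero, one_pow] at h
  refine h.congr' ?_
  filter_upwards [Filter.eventually_gt_atTop 0] with n hn
  have : (n : ℝ) ≠ 0 := by positivity
  field_simp

theorem R_four_asymptotic :
    Filter.Tendsto (fun n : ℕ => (R 4 n : ℝ) / (n : ℝ) ^ 3) Filter.atTop
      (nhds (1 / 9)) := by
  refine tendsto_of_tendsto_of_tendsto_of_le_of_le' (shift_tendsto (-20)) (shift_tendsto 9) ?_ ?_
  · filter_upwards [Filter.eventually_ge_atTop 20] with n hn
    have := R_lower n hn
    rw [sub_eq_add_neg] at this
    gcongr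
  · filter_upwards [Filter.eventually_ge_atTop 20] with n hn
    have := R_upper n hn
    gcongr
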